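/- The family 𝒜 = (A_{x,L})_{x∈E, L≥1 integer}, where A_{x,L} = {σ ∈ {0,1}^E : B(x,L) is connected to ∂_int B(x,2L) by a nearest-neighbor path on which σ vanishes identically}, is a family of decreasing events on {0,1}^E that cascades with complexity at most α + β/2. -/

import Mathlib

open MeasureTheory Filter Set
open scoped ENNReal NNReal Topology Classical

noncomputable section

/-- The weighted graph `G`: an infinite connected graph of bounded degree, with a weight
`ρG` which is uniformly bounded and uniformly positive on edges, `α`-Ahlfors regular. -/
structure GraphSetup where
  V : Type
  infV : Infinite V
  adjG : V → V → Prop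
  adjG_symm : ∀ {y y'}, adjG y y' → adjG y' y
  adjG_irrefl : ∀ y, ¬adjG y y
  /-- `dG` is the graph distance on `G`; this characterization also encodes connectedness. -/
  dG : V → V → ℕ
  dG_spec : ∀ (y y' : V) (n : ℕ), dG y y' ≤ n ↔
    ∃ p : ℕ → V, p 0 = y ∧ p n = y' ∧ ∀ i < n, p i = p (i + 1) ∨ adjG (p i) (p (i + 1))
  ballG_fin : ∀ (y : V) (R : ℝ), {y' | (dG y y' : ℝ) ≤ R}.Finite
  degBound : ℕ
  deg_fin : ∀ y : V, {y' | adjG y y'}.Finite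
  deg_le : ∀ y : V, Nat.card {y' // adjG y y'} ≤ degBound
  ρG : V → V → ℝ
  ρG_symm : ∀ y y', ρG y y' = ρG y' y
  ρG_nonneg : ∀ y y', 0 ≤ ρG y y'
  ρG_pos_iff : ∀ y y', 0 < ρG y y' ↔ adjG y y'
  ρG_lbd : ℝ
  ρG_ubd : ℝ
  ρG_lbd_pos : 0 < ρG_lbd
  ρG_bounds : ∀ y y', adjG y y' → ρG_lbd ≤ ρG y y' ∧ ρG y y' ≤ ρG_ubd
  α : ℝ
  β : ℝ
  α_gt_one : 1 < α
  β_ge_two : 2 ≤ β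
  β_le_α_add_one : β ≤ α + 1
  cA : ℝ
  cA' : ℝ
  cA_pos : 0 < cA
  /-- `α`-Ahlfors regularity of `(G, ρG)`, lower bound. -/
  ahlfors_lb : ∀ (y : V) (R : ℝ), 1 / 2 ≤ R →
    cA * R ^ α ≤ ∑ y' ∈ (ballG_fin y R).toFinset, ∑' y'', ρG y' y''
  /-- `α`-Ahlfors regularity of `(G, ρG)`, upper bound. -/
  ahlfors_ub : ∀ (y : V) (R : ℝ), 1 / 2 ≤ R →
    (∑ y' ∈ (ballG_fin y R).toFinset, ∑' y'', ρG y' y'') ≤ cA' * R ^ α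

namespace GraphSetup

/-- The product graph `E = G × ℤ`. -/
abbrev E (S : GraphSetup) : Type := S.V × ℤ

instance (S : GraphSetup) : MeasurableSpace S.V := ⊤

/-- The exponent `ν = α - β/2`. -/
def ν (S : GraphSetup) : ℝ := S.α - S.β / 2

/-- Adjacency on `E = G × ℤ`. -/
def adjE (S : GraphSetup) (x x' : S.E) : Prop :=
  (x.2 = x'.2 ∧ S.adjG x.1 x'.1) ∨ (x.1 = x'.1 ∧ (x.2 - x'.2).natAbs = 1)

/-- The weight on `E`: `ρG` on horizontal edges, `1` on vertical edges. -/
def ρE (S : GraphSetup) (x x' : S.E) : ℝ :=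
  if x.2 = x'.2 then S.ρG x.1 x'.1
  else if x.1 = x'.1 ∧ (x.2 - x'.2).natAbs = 1 then 1 else 0

/-- `ρ(x) = Σ_{x' ~ x} ρ_{x,x'}`. -/
def ρEpt (S : GraphSetup) (x : S.E) : ℝ := ∑' x', S.ρE x x'

/-- Transition probability of the walk on `E`. -/
def ptrans (S : GraphSetup) (x x' : S.E) : ℝ := S.ρE x x' / S.ρEpt x

/-- The metric `d((y,z),(y',z')) = max (d_G(y,y'), |z - z'|^{2/β})` on `E`. -/
def dE (S : GraphSetup) (x x' : S.E) : ℝ :=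
  max (S.dG x.1 x'.1 : ℝ) (|(x.2 : ℝ) - (x'.2 : ℝ)| ^ (2 / S.β))

/-- Closed `d`-ball in `E`. -/
def ball (S : GraphSetup) (x : S.E) (r : ℝ) : Set S.E := {x' | S.dE x x' ≤ r}

/-- Vertex boundary `∂U`. -/
def vBoundary (S : GraphSetup) (U : Set S.E) : Set S.E :=
  {x | x ∉ U ∧ ∃ x' ∈ U, S.adjE x x'}

/-- Closure `U ∪ ∂U`. -/
def cl (S : GraphSetup) (U : Set S.E) : Set S.E := U ∪ S.vBoundary U

/-- Interior vertex boundary `∂_int U`. -/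
def intBoundary (S : GraphSetup) (U : Set S.E) : Set S.E :=
  {x | x ∈ U ∧ ∃ x', x' ∉ U ∧ S.adjE x x'}

/-- A nearest-neighbour path of length `n` contained in `A`. -/
def IsPathIn (S : GraphSetup) (A : Set S.E) (p : ℕ → S.E) (n : ℕ) : Prop :=
  (∀ i ≤ n, p i ∈ A) ∧ ∀ i < n, S.adjE (p i) (p (i + 1))

/-- `B₁` is connected to `B₂` by a nearest-neighbour path contained in `A`. -/
def ConnectsIn (S : GraphSetup) (A B₁ B₂ : Set S.E) : Prop :=
  ∃ (n : ℕ) (p : ℕ → S.E), S.IsPathIn A p n ∧ p 0 ∈ B₁ ∧ p n ∈ B₂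

/-- The connected component of `x` inside `A`. -/
def component (S : GraphSetup) (A : Set S.E) (x : S.E) : Set S.E :=
  {x' | S.ConnectsIn A {x} {x'}}

/-- `A` is a connected subset of `E`. -/
def IsConnectedSet (S : GraphSetup) (A : Set S.E) : Prop :=
  ∀ x ∈ A, ∀ x' ∈ A, S.ConnectsIn A {x} {x'}

/-- `C` separates `A` and `B` in `U`: the graph distance between `A` and `B` exceeds `1`
and every nearest-neighbour path from `∂A` to `∂B` remaining in `U` meets `C`. -/
def Separates (S : GraphSetup) (A B C U : Set S.E) : Prop :=
  (∀ a ∈ A, ∀ b ∈ B, a ≠ b ∧ ¬S.adjE a b) ∧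
  ∀ (n : ℕ) (p : ℕ → S.E), (∀ i ≤ n, p i ∈ U) → (∀ i < n, S.adjE (p i) (p (i + 1))) →
    p 0 ∈ S.vBoundary A → p n ∈ S.vBoundary B → ∃ i ≤ n, p i ∈ C

/-- The separation event `S_{x,L}`. -/
def sepEvent (S : GraphSetup) (x : S.E) (L : ℕ) : Set (Set S.E) :=
  {C | ∃ A₁ A₂ : Set S.E,
    A₁ ⊆ S.cl (S.ball x (3 * L)) ∧ A₂ ⊆ S.cl (S.ball x (3 * L)) ∧
    S.IsConnectedSet A₁ ∧ S.IsConnectedSet A₂ ∧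
    (∃ a ∈ A₁, ∃ a' ∈ A₁, (L : ℝ) ≤ S.dE a a') ∧
    (∃ a ∈ A₂, ∃ a' ∈ A₂, (L : ℝ) ≤ S.dE a a') ∧
    S.Separates A₁ A₂ C (S.ball x (5 * L))}

/-- A half-plane of `E = G × ℤ`: the product of a semi-infinite geodesic in `G` with `ℤ`. -/
structure HalfPlane (S : GraphSetup) where
  ray : ℕ → S.V
  geodesic : ∀ n m : ℕ, S.dG (ray n) (ray m) = Nat.dist n m

/-- The set of points of a half-plane. -/
def HalfPlane.carrier {S : GraphSetup} (P : S.HalfPlane) : Set S.E :=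
  {x | ∃ n, x.1 = P.ray n}

/-- `B₁` is connected to `B₂` by a `*`-path contained in `A ∩ 𝒫`. -/
def StarConnectsIn (S : GraphSetup) (P : S.HalfPlane) (A B₁ B₂ : Set S.E) : Prop :=
  ∃ (n : ℕ) (p : ℕ → S.E),
    (∀ i ≤ n, p i ∈ A ∧ p i ∈ P.carrier) ∧
    (∀ i < n, p i ≠ p (i + 1) ∧ S.dG (p i).1 (p (i + 1)).1 ≤ 1 ∧
      ((p i).2 - (p (i + 1)).2).natAbs ≤ 1) ∧
    p 0 ∈ B₁ ∧ p n ∈ B₂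

/-- An increasing event on `{0,1}^E` (configurations identified with subsets of `E`). -/
def IncreasingEvent (S : GraphSetup) (A : Set (Set S.E)) : Prop :=
  ∀ C C' : Set S.E, C ⊆ C' → C ∈ A → C' ∈ A

/-- A decreasing event on `{0,1}^E`. -/
def DecreasingEvent (S : GraphSetup) (A : Set (Set S.E)) : Prop :=
  ∀ C C' : Set S.E, C' ⊆ C → C ∈ A → C' ∈ A

/-- The event `A` only depends on the coordinates in `B`. -/
def DependsOn (S : GraphSetup) (A : Set (Set S.E)) (B : Set S.E) : Prop :=
  ∀ C C' : Set S.E, C ∩ B = C' ∩ B → (C ∈ A ↔ C' ∈ A)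

/-- The family `(G_{x,L})` cascades with complexity at most `lam`, with constant `c`. -/
def CascadesLe (S : GraphSetup) (Gf : S.E → ℕ → Set (Set S.E)) (lam c : ℝ) : Prop :=
  (∀ (x : S.E) (L : ℕ), 1 ≤ L → S.DependsOn (Gf x L) (S.ball x (10 * L))) ∧
  ∀ (ℓ : ℕ) (x : S.E) (L : ℕ), 1 ≤ L → 0 < ℓ → 100 ∣ ℓ →
    ∃ Λ : Finset S.E, ↑Λ ⊆ S.ball x (9 * ℓ * L) ∧ (Λ.card : ℝ) ≤ c * (ℓ : ℝ) ^ lam ∧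
      Gf x (ℓ * L) ⊆
        ⋃ x' ∈ Λ, ⋃ x'' ∈ Λ,
          ⋃ (_ : ((ℓ * L : ℕ) : ℝ) / 100 ≤ S.dE x' x''), Gf x' L ∩ Gf x'' L

/-- The length scales `L_n = ℓ₀ⁿ L₀`. -/
def Lscale (ℓ₀ L₀ n : ℕ) : ℕ := ℓ₀ ^ n * L₀

/-- Membership in `Λ_n`: an embedding of the dyadic tree of depth `n` in `E`,
with nested balls and spread-out children. -/
def IsTreeEmbed (S : GraphSetup) (ℓ₀ L₀ n : ℕ) (T : ∀ k : ℕ, (Fin k → Bool) → S.E) : Prop :=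
  ∀ k < n, ∀ (m : Fin k → Bool) (b : Bool),
    S.ball (T (k + 1) (Fin.snoc m b)) (10 * Lscale ℓ₀ L₀ (n - (k + 1))) ⊆
        S.ball (T k m) (10 * Lscale ℓ₀ L₀ (n - k)) ∧
      ((Lscale ℓ₀ L₀ (n - k) : ℝ)) / 100 ≤
        S.dE (T (k + 1) (Fin.snoc m false)) (T (k + 1) (Fin.snoc m true))

/-- The factor `1 + c₁ √K (k+1)^{-3/2} ℓ₀^{-(ν-ν')/2}`. -/
def decFactor (c₁ K νv ν' : ℝ) (ℓ₀ : ℕ) (k : ℕ) : ℝ :=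
  1 + c₁ * Real.sqrt K * ((k : ℝ) + 1) ^ (-(3 : ℝ) / 2) * (ℓ₀ : ℝ) ^ (-(νv - ν') / 2)

/-- The increasing sequence of levels `u_n⁺`. -/
def uPlusSeq (c₁ K νv ν' : ℝ) (ℓ₀ : ℕ) (u₀ : ℝ) (n : ℕ) : ℝ :=
  (∏ k ∈ Finset.range n, decFactor c₁ K νv ν' ℓ₀ k) * u₀

/-- The decreasing sequence of levels `u_n⁻`. -/
def uMinusSeq (c₁ K νv ν' : ℝ) (ℓ₀ : ℕ) (u₀ : ℝ) (n : ℕ) : ℝ :=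
  (∏ k ∈ Finset.range n, (decFactor c₁ K νv ν' ℓ₀ k)⁻¹) * u₀

/-- The limit `u_∞⁺` of `u_n⁺`. -/
def uPlusInf (c₁ K νv ν' : ℝ) (ℓ₀ : ℕ) (u₀ : ℝ) : ℝ := ⨆ n, uPlusSeq c₁ K νv ν' ℓ₀ u₀ n

/-- The limit `u_∞⁻` of `u_n⁻`. -/
def uMinusInf (c₁ K νv ν' : ℝ) (ℓ₀ : ℕ) (u₀ : ℝ) : ℝ := ⨅ n, uMinusSeq c₁ K νv ν' ℓ₀ u₀ n

/-- The error term `ε(u) = 2 e^{-K u L₀^ν ℓ₀^{ν'}} / (1 - e^{-K u L₀^ν ℓ₀^{ν'}})`. -/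
def epsDecouple (K u : ℝ) (L₀ ℓ₀ : ℕ) (νv ν' : ℝ) : ℝ :=
  2 * Real.exp (-(K * u * (L₀ : ℝ) ^ νv * (ℓ₀ : ℝ) ^ ν')) /
    (1 - Real.exp (-(K * u * (L₀ : ℝ) ^ νv * (ℓ₀ : ℝ) ^ ν')))

/-- The canonical law of the random walk on `E`, as a family of measures on trajectories. -/
structure WalkLaw (S : GraphSetup) where
  P : S.E → Measure (ℕ → S.E)
  isProb : ∀ x, IsProbabilityMeasure (P x)
  cyl : ∀ (x : S.E) (n : ℕ) (q : ℕ → S.E), q 0 = x →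
    P x {w | ∀ i ≤ n, w i = q i} =
      ENNReal.ofReal (∏ i ∈ Finset.range n, S.ptrans (q i) (q (i + 1)))
  cyl0 : ∀ (x : S.E) (q : ℕ → S.E), q 0 ≠ x → P x {w | w 0 = q 0} = 0

instance {S : GraphSetup} (W : WalkLaw S) (x : S.E) : IsProbabilityMeasure (W.P x) :=
  W.isProb x

namespace WalkLaw

variable {S : GraphSetup}

/-- `P_x[H_K < ∞]`, the probability to ever enter `K`. -/
def hitProb (W : WalkLaw S) (x : S.E) (K : Set S.E) : ℝ≥0∞ := W.P x {w | ∃ n, w n ∈ K}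

/-- `P_x[H̃_K = ∞]`, the probability never to hit `K` at a positive time. -/
def escProb (W : WalkLaw S) (x : S.E) (K : Set S.E) : ℝ≥0∞ :=
  W.P x {w | ∀ n, 1 ≤ n → w n ∉ K}

/-- `P_x[H_K < ∞, X_{H_K} = x']`, the probability to enter `K` for the first time at `x'`. -/
def entersAt (W : WalkLaw S) (x : S.E) (K : Set S.E) (x' : S.E) : ℝ≥0∞ :=
  W.P x {w | ∃ n, w n = x' ∧ ∀ m < n, w m ∉ K}

/-- The equilibrium measure `e_K`. -/
def equilibrium (W : WalkLaw S) (K : Set S.E) (x : S.E) : ℝ :=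
  if x ∈ K then (W.escProb x K).toReal * S.ρEpt x else 0

/-- The capacity `cap(K) = Σ_{x ∈ K} P_x[H̃_K = ∞] ρ(x)`. -/
def capacity (W : WalkLaw S) (K : Set S.E) : ℝ :=
  ∑' x : K, (W.escProb x.1 K).toReal * S.ρEpt x.1

/-- The Green density `g(x,x') = Σ_{n ≥ 0} P_x[X_n = x'] / ρ(x')`. -/
def green (W : WalkLaw S) (x x' : S.E) : ℝ :=
  (∑' n : ℕ, (W.P x {w | w n = x'}).toReal) / S.ρEpt x'

/-- The standing assumption `c (d(x,x') ∨ 1)^{-ν} ≤ g(x,x') ≤ c' (d(x,x') ∨ 1)^{-ν}`. -/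
def GreenBounds (W : WalkLaw S) (cg cg' : ℝ) : Prop :=
  0 < cg ∧ cg ≤ cg' ∧ ∀ x x' : S.E,
    cg * (max (S.dE x x') 1) ^ (-S.ν) ≤ W.green x x' ∧
      W.green x x' ≤ cg' * (max (S.dE x x') 1) ^ (-S.ν)

end WalkLaw

/-- Random interlacements on `E`, encoded by their canonical probability space and the
family of interlacement sets `ℐ^u`, `u ≥ 0`, with
`ℙ[𝒱^u ⊇ K] = exp(-u cap(K))` for all finite `K`. -/
structure Interlacement (S : GraphSetup) (W : WalkLaw S) where
  Ω : Type
  mΩ : MeasurableSpace Ω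
  prob : @Measure Ω mΩ
  isProb : IsProbabilityMeasure prob
  I : ℝ → Ω → Set S.E
  I_mono : ∀ u u' : ℝ, u ≤ u' → ∀ ω, I u ω ⊆ I u' ω
  vacant_law : ∀ u : ℝ, 0 ≤ u → ∀ K : Set S.E, K.Finite →
    prob {ω | Disjoint K (I u ω)} = ENNReal.ofReal (Real.exp (-(u * W.capacity K)))

namespace Interlacement

variable {S : GraphSetup} {W : WalkLaw S}

/-- The vacant set `𝒱^u = E ∖ ℐ^u`. -/
def vacant (RI : Interlacement S W) (u : ℝ) (ω : RI.Ω) : Set S.E := (RI.I u ω)ᶜ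

/-- The event that `x` lies in an infinite connected component of `𝒱^u`. -/
def percolates (RI : Interlacement S W) (x : S.E) (u : ℝ) : Set RI.Ω :=
  {ω | (S.component (RI.vacant u ω) x).Infinite}

/-- The one-arm event: `B(x,L)` is connected to `∂_int B(x,2L)` in `𝒱^u`. -/
def oneArm (RI : Interlacement S W) (x : S.E) (L : ℝ) (u : ℝ) : Set RI.Ω :=
  {ω | S.ConnectsIn (RI.vacant u ω) (S.ball x L) (S.intBoundary (S.ball x (2 * L)))}

/-- `sup_{x ∈ E} ℙ[B(x,L) ↔ ∂_int B(x,2L) in 𝒱^u]`. -/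
def oneArmSup (RI : Interlacement S W) (u : ℝ) (L : ℕ) : ℝ≥0∞ :=
  ⨆ x : S.E, RI.prob (RI.oneArm x L u)

/-- The set defining `u_*`. -/
def uStarSet (RI : Interlacement S W) : Set ℝ :=
  {u | 0 ≤ u ∧ ∀ x : S.E, RI.prob (RI.percolates x u) = 0}

/-- The critical level `u_*`. -/
def uStar (RI : Interlacement S W) : ℝ := sInf RI.uStarSet

/-- The set defining `u_**`. -/
def uStarStarSet (RI : Interlacement S W) : Set ℝ :=
  {u | 0 ≤ u ∧ Filter.liminf (fun L : ℕ => RI.oneArmSup u L) Filter.atTop = 0}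

/-- The critical level `u_**`. -/
def uStarStar (RI : Interlacement S W) : ℝ := sInf RI.uStarStarSet

/-- The `*`-crossing event for `ℐ^u` inside a half-plane. -/
def starCross (RI : Interlacement S W) (P : S.HalfPlane) (x : S.E) (L : ℝ) (u : ℝ) :
    Set RI.Ω :=
  {ω | S.StarConnectsIn P (RI.I u ω) (S.ball x L) (S.intBoundary (S.ball x (2 * L)))}

/-- `sup_{𝒫, x ∈ 𝒫} ℙ[B(x,L) ↔* ∂_int B(x,2L) in ℐ^u ∩ 𝒫]`. -/
def starSup (RI : Interlacement S W) (u : ℝ) (L : ℕ) : ℝ≥0∞ :=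
  ⨆ P : S.HalfPlane, ⨆ x : P.carrier, RI.prob (RI.starCross P x.1 L u)

/-- The set defining `ũ`. -/
def uTildeSet (RI : Interlacement S W) : Set ℝ :=
  {u | 0 ≤ u ∧ 0 < Filter.liminf (fun L : ℕ => RI.starSup u L) Filter.atTop}

/-- The critical level `ũ`. -/
def uTilde (RI : Interlacement S W) : ℝ := sInf RI.uTildeSet

/-- For an event `A` on `{0,1}^E`, the event `A^u` that the indicator of `ℐ^u` lies in `A`. -/
def eventAt (RI : Interlacement S W) (A : Set (Set S.E)) (u : ℝ) : Set RI.Ω :=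
  {ω | RI.I u ω ∈ A}

end Interlacement

end GraphSetup

open GraphSetup

theorem Finset.exists_separated_net {ι : Type*} (r : ι → ι → Prop)
    (hrefl : ∀ a, r a a) (hsymm : ∀ a b, r a b → r b a) (F : Finset ι) :
    ∃ N ⊆ F, (∀ a ∈ N, ∀ b ∈ N, a ≠ b → ¬ r a b) ∧ ∀ a ∈ F, ∃ b ∈ N, r a b := by
  induction F using Finset.induction_on with
  | empty => exact ⟨∅, by simp⟩
  | insert a F _ ih =>
    obtain ⟨N, hNF, hsep, hcov⟩ := ih
    by_cases h : ∃ b ∈ N, r a b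
    · refine ⟨N, hNF.trans (Finset.subset_insert _ _), hsep, fun c hc => ?_⟩
      rcases Finset.mem_insert.1 hc with rfl | hc
      exacts [h, hcov c hc]
    · push Not at h
      refine ⟨insert a N, Finset.insert_subset_insert _ hNF, fun b hb c hc hbc => ?_,
        fun c hc => ?_⟩
      · rcases Finset.mem_insert.1 hb with rfl | hbN <;>
          rcases Finset.mem_insert.1 hc with rfl | hcN
        · exact absurd rfl hbc
        · exact h c hcN
        · exact fun hr => h b hbN (hsymm _ _ hr)
        · exact hsep b hbN c hcN hbc
      · rcases Finset.mem_insert.1 hc with rfl | hc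
        · exact ⟨c, Finset.mem_insert_self _ _, hrefl c⟩
        · obtain ⟨b, hb, hr⟩ := hcov c hc
          exact ⟨b, Finset.mem_insert_of_mem hb, hr⟩

/-- Covering of an interval of `ℤ` of half-length `(2ℓL) ^ b` by intervals of
half-length `L ^ b`. -/
theorem Int.exists_net {b : ℝ} (hb : 0 ≤ b) {ℓ L : ℕ} (hℓ : 1 ≤ ℓ) (hL : 1 ≤ L) (z : ℤ) :
    ∃ N : Finset ℤ, (N.card : ℝ) ≤ (4 * 2 ^ b + 3) * (ℓ : ℝ) ^ b ∧
      ∀ t : ℤ, |(z : ℝ) - t| ≤ (2 * ℓ * L : ℝ) ^ b →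
        ∃ t' ∈ N, |(t : ℝ) - t'| ≤ (L : ℝ) ^ b := by
  have hℓ' : (1 : ℝ) ≤ (ℓ : ℝ) ^ b := Real.one_le_rpow (mod_cast hℓ) hb
  have hL' : (1 : ℝ) ≤ (L : ℝ) ^ b := Real.one_le_rpow (mod_cast hL) hb
  obtain ⟨m, hm⟩ : ∃ m, m = ⌊(L : ℝ) ^ b⌋₊ := ⟨_, rfl⟩
  have hm1 : 1 ≤ m := hm ▸ Nat.le_floor (by simpa)
  have hm1' : (1 : ℝ) ≤ m := mod_cast hm1
  have hmle : (m : ℝ) ≤ (L : ℝ) ^ b := hm ▸ Nat.floor_le (by linarith)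
  have hmlt : (L : ℝ) ^ b < m + 1 := hm ▸ Nat.lt_floor_add_one _
  obtain ⟨μ, hμ⟩ : ∃ μ : ℝ, μ = (2 * ℓ * L : ℝ) ^ b / m := ⟨_, rfl⟩
  have hμ0 : 0 ≤ μ := by rw [hμ]; positivity
  have hμm : μ * m = (2 * ℓ * L : ℝ) ^ b := by rw [hμ]; field_simp
  have hμle : μ ≤ 2 * 2 ^ b * (ℓ : ℝ) ^ b := by
    rw [hμ, div_le_iff₀ (by linarith), Real.mul_rpow (by positivity) (by positivity),
      Real.mul_rpow (by positivity) (by positivity)]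
    have : 0 ≤ (2 : ℝ) ^ b * (ℓ : ℝ) ^ b := by positivity
    nlinarith
  refine ⟨(Finset.Icc (-(⌊μ⌋₊ + 1 : ℤ)) (⌊μ⌋₊ + 1)).image fun k => z + k * m, ?_, ?_⟩
  · have h1 := Nat.floor_le hμ0
    calc _ ≤ (((Finset.Icc (-(⌊μ⌋₊ + 1 : ℤ)) (⌊μ⌋₊ + 1)).card : ℕ) : ℝ) :=
          mod_cast Finset.card_image_le
      _ = ((2 * ⌊μ⌋₊ + 3 : ℕ) : ℝ) := by
          rw [Int.card_Icc]; congr 1; omega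
      _ ≤ _ := by push_cast; nlinarith
  · intro t ht
    rw [← hμm, abs_le] at ht
    have hmz : (0 : ℤ) < m := by omega
    have hmod0 := Int.emod_nonneg (t - z) hmz.ne'
    have hmod1 := Int.emod_lt_of_pos (t - z) hmz
    have heq := Int.mul_ediv_add_emod (t - z) m
    obtain ⟨k, hk⟩ : ∃ k, k = (t - z) / (m : ℤ) := ⟨_, rfl⟩
    obtain ⟨r, hr⟩ : ∃ r, r = (t - z) % (m : ℤ) := ⟨_, rfl⟩
    rw [← hk, ← hr] at heq
    rw [← hr] at hmod0 hmod1
    have heq' : (m : ℝ) * k + r = t - z := mod_cast heq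
    have hr0 : (0 : ℝ) ≤ r := mod_cast hmod0
    have hr1 : (r : ℝ) < m := mod_cast hmod1
    have hfl := Nat.lt_floor_add_one μ
    refine ⟨z + k * m, Finset.mem_image.2 ⟨k, Finset.mem_Icc.2 ⟨?_, ?_⟩, rfl⟩, ?_⟩
    · have h : -(μ + 1) < (k : ℝ) := by
        by_contra! hc
        nlinarith
      have : (-(⌊μ⌋₊ + 1 + 1) : ℝ) < k := by linarith
      have : (-(⌊μ⌋₊ + 1 + 1) : ℤ) < k := by exact_mod_cast this
      omega
    · have h : (k : ℝ) ≤ μ := by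
        by_contra! hc
        nlinarith
      have : (k : ℝ) < ⌊μ⌋₊ + 1 := by linarith
      have : k < (⌊μ⌋₊ + 1 : ℤ) := by exact_mod_cast this
      omega
    · push_cast
      rw [show (t : ℝ) - (z + k * m) = r by linarith, abs_of_nonneg hr0]
      linarith

namespace GraphSetup

variable (S : GraphSetup)

theorem dG_self (y : S.V) : S.dG y y = 0 :=
  Nat.le_zero.1 ((S.dG_spec y y 0).2 ⟨fun _ => y, rfl, rfl, by simp⟩)

theorem dG_comm (y y' : S.V) : S.dG y y' = S.dG y' y := by
  have key : ∀ y y' : S.V, S.dG y' y ≤ S.dG y y' := fun y y' => by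
    obtain ⟨p, h0, h1, hp⟩ := (S.dG_spec y y' _).1 le_rfl
    refine (S.dG_spec _ _ _).2 ⟨fun i => p (S.dG y y' - i), by simpa, by simpa, fun i hi => ?_⟩
    have h := hp (S.dG y y' - (i + 1)) (by omega)
    rw [show S.dG y y' - (i + 1) + 1 = S.dG y y' - i by omega] at h
    exact h.imp Eq.symm S.adjG_symm
  exact le_antisymm (key _ _) (key _ _)

theorem dG_triangle (a b c : S.V) : S.dG a c ≤ S.dG a b + S.dG b c := by
  obtain ⟨p, p0, p1, hp⟩ := (S.dG_spec a b _).1 le_rfl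
  obtain ⟨q, q0, q1, hq⟩ := (S.dG_spec b c _).1 le_rfl
  refine (S.dG_spec _ _ _).2
    ⟨fun i => if i ≤ S.dG a b then p i else q (i - S.dG a b), by simpa, ?_, fun i hi => ?_⟩
  · by_cases h : S.dG b c = 0
    · rw [h] at q1
      have hbc : b = c := q0.symm.trans q1
      simp only [h, add_zero, le_refl, if_true, p1]
      exact hbc
    · simp [h, q1]
  · rcases lt_trichotomy i (S.dG a b) with h | h | h
    · simpa [h.le, Nat.succ_le_of_lt h] using hp i h
    · have := hq 0 (by omega)
      subst h
      simpa [p1, q0] using this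
    · have := hq (i - S.dG a b) (by omega)
      rw [show i - S.dG a b + 1 = i + 1 - S.dG a b by omega] at this
      simpa [h.not_ge, show ¬ i + 1 ≤ S.dG a b by omega] using this

theorem β_pos : 0 < S.β := by linarith [S.β_ge_two]

theorem dE_comm (x x' : S.E) : S.dE x x' = S.dE x' x := by
  rw [dE, dE, S.dG_comm, abs_sub_comm]

theorem dE_triangle (a b c : S.E) : S.dE a c ≤ S.dE a b + S.dE b c := by
  have hβ := S.β_pos
  refine max_le ?_ ?_
  · calc (S.dG a.1 c.1 : ℝ) ≤ S.dG a.1 b.1 + S.dG b.1 c.1 := mod_cast S.dG_triangle _ _ _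
      _ ≤ _ := add_le_add (le_max_left _ _) (le_max_left _ _)
  · calc |(a.2 : ℝ) - c.2| ^ (2 / S.β)
        ≤ (|(a.2 : ℝ) - b.2| + |(b.2 : ℝ) - c.2|) ^ (2 / S.β) :=
          Real.rpow_le_rpow (abs_nonneg _) (abs_sub_le _ _ _) (by positivity)
      _ ≤ |(a.2 : ℝ) - b.2| ^ (2 / S.β) + |(b.2 : ℝ) - c.2| ^ (2 / S.β) :=
          Real.rpow_add_le_add_rpow (abs_nonneg _) (abs_nonneg _) (by positivity)
            ((div_le_one hβ).2 S.β_ge_two)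
      _ ≤ _ := add_le_add (le_max_right _ _) (le_max_right _ _)

theorem dE_le_iff (x x' : S.E) {r : ℝ} (hr : 0 ≤ r) :
    S.dE x x' ≤ r ↔ (S.dG x.1 x'.1 : ℝ) ≤ r ∧ |(x.2 : ℝ) - x'.2| ≤ r ^ (S.β / 2) := by
  have hβ := S.β_pos
  rw [dE, max_le_iff, ← inv_div, Real.rpow_inv_le_iff_of_pos (abs_nonneg _) hr (by positivity)]

theorem dE_le_one_of_adjE {x x' : S.E} (h : S.adjE x x') : S.dE x x' ≤ 1 := by
  rw [S.dE_le_iff _ _ zero_le_one, Real.one_rpow]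
  rcases h with ⟨h2, h1⟩ | ⟨h1, h2⟩
  · refine ⟨?_, by simp [h2]⟩
    exact_mod_cast (S.dG_spec x.1 x'.1 1).2
      ⟨fun i => if i = 0 then x.1 else x'.1, by simp, by simp, by simp [h1]⟩
  · refine ⟨by simp [h1, S.dG_self], ?_⟩
    rw [← Int.cast_sub, ← Int.cast_abs]
    norm_cast
    exact (Int.natCast_natAbs _ ▸ congrArg Nat.cast h2).le

theorem adjE_symm {x x' : S.E} (h : S.adjE x x') : S.adjE x' x := by
  rcases h with ⟨h2, h1⟩ | ⟨h1, h2⟩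
  · exact Or.inl ⟨h2.symm, S.adjG_symm h1⟩
  · exact Or.inr ⟨h1.symm, by omega⟩

variable {S}

theorem IsPathIn.reverse {A : Set S.E} {p : ℕ → S.E} {n : ℕ} (h : S.IsPathIn A p n) :
    S.IsPathIn A (fun i => p (n - i)) n := by
  refine ⟨fun i _ => h.1 _ (Nat.sub_le _ _), fun i hi => S.adjE_symm ?_⟩
  have := h.2 (n - (i + 1)) (by omega)
  rwa [show n - (i + 1) + 1 = n - i by omega] at this

/-- A path that starts in `U` and leaves it meets the interior boundary of `U` before leaving. -/
theorem IsPathIn.connectsIn_intBoundary {A B U : Set S.E} {p : ℕ → S.E} {n : ℕ}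
    (h : S.IsPathIn A p n) (hB : p 0 ∈ B) (h0 : p 0 ∈ U) (hn : ∃ i ≤ n, p i ∉ U) :
    S.ConnectsIn (A ∩ U) B (S.intBoundary U) := by
  have hex : ∃ i, p i ∉ U := hn.imp fun _ => And.right
  obtain ⟨i, hin, hi⟩ := hn
  have hle : Nat.find hex ≤ n := (Nat.find_min' hex hi).trans hin
  have hpos : Nat.find hex ≠ 0 := fun h => (h ▸ Nat.find_spec hex) h0
  obtain ⟨k, hk⟩ := Nat.exists_eq_succ_of_ne_zero hpos
  have hU : ∀ j ≤ k, p j ∈ U := fun j hj => not_not.1 (Nat.find_min hex (by omega))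
  refine ⟨k, p, ⟨fun j hj => ⟨h.1 j (by omega), hU j hj⟩, fun j hj => h.2 j (by omega)⟩, hB,
    hU k le_rfl, p (k + 1), ?_, h.2 k (by omega)⟩
  have := Nat.find_spec hex
  rwa [hk] at this

theorem ConnectsIn.mono {A A' B B' : Set S.E} (hA : A ⊆ A') (h : S.ConnectsIn A B B') :
    S.ConnectsIn A' B B' := by
  obtain ⟨n, p, hp, h0, h1⟩ := h
  exact ⟨n, p, ⟨fun i hi => hA (hp.1 i hi), hp.2⟩, h0, h1⟩

theorem ConnectsIn.inter_of_subset {A B U : Set S.E} (hBU : B ⊆ U)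
    (h : S.ConnectsIn A B (S.intBoundary U)) : S.ConnectsIn (A ∩ U) B (S.intBoundary U) := by
  obtain ⟨n, p, hp, h0, h1⟩ := h
  by_cases hU : ∃ i ≤ n, p i ∉ U
  · exact hp.connectsIn_intBoundary h0 (hBU h0) hU
  · push Not at hU
    exact ⟨n, p, ⟨fun i hi => ⟨hp.1 i hi, hU i hi⟩, hp.2⟩, h0, h1⟩

theorem ball_mono (x : S.E) {r R : ℝ} (h : r ≤ R) : S.ball x r ⊆ S.ball x R :=
  fun _ hx => le_trans hx h

theorem lt_dE_of_mem_intBoundary {x p : S.E} {R : ℝ} (h : p ∈ S.intBoundary (S.ball x R)) :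
    R - 1 < S.dE x p := by
  obtain ⟨-, q, hq, hadj⟩ := h
  have hlt : R < S.dE x q := not_le.1 hq
  linarith [S.dE_triangle x p q, S.dE_le_one_of_adjE hadj]

theorem IsPathIn.connectsIn_ball {A : Set S.E} {p : ℕ → S.E} {n : ℕ} (h : S.IsPathIn A p n)
    {x : S.E} {r R : ℝ} (hrR : r ≤ R) (h0 : S.dE x (p 0) ≤ r) (hn : R < S.dE x (p n)) :
    S.ConnectsIn A (S.ball x r) (S.intBoundary (S.ball x R)) :=
  (h.connectsIn_intBoundary h0 (ball_mono x hrR h0) ⟨n, le_rfl, not_le.2 hn⟩).mono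
    inter_subset_left

variable (S)

/-- Upper bound on the size of `L`-separated subsets of a ball of radius `2ℓL` in `G`. -/
theorem card_le_of_separated {ℓ L : ℕ} (hℓ : 1 ≤ ℓ) (hL : 1 ≤ L) (y : S.V) (N : Finset S.V)
    (hN : ∀ a ∈ N, (S.dG y a : ℝ) ≤ 2 * ℓ * L)
    (hsep : ∀ a ∈ N, ∀ b ∈ N, a ≠ b → ¬ S.dG a b ≤ L) :
    (N.card : ℝ) ≤ S.cA' / S.cA * 6 ^ S.α * (ℓ : ℝ) ^ S.α := by
  have hℓ' : (1 : ℝ) ≤ ℓ := mod_cast hℓ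
  have hL' : (1 : ℝ) ≤ L := mod_cast hL
  set w : S.V → ℝ := fun a => ∑' b, S.ρG a b
  have hw : ∀ a, 0 ≤ w a := fun a => tsum_nonneg (S.ρG_nonneg a)
  set Bl : S.V → Finset S.V := fun a => (S.ballG_fin a (L / 2)).toFinset
  have hdisj : (N : Set S.V).PairwiseDisjoint Bl := fun a ha b hb hab => by
    refine Finset.disjoint_left.2 fun c hca hcb => hsep a ha b hb hab ?_
    simp only [Bl, Set.Finite.mem_toFinset, mem_ofPred_eq] at hca hcb
    have := S.dG_triangle a c b
    rw [S.dG_comm c b] at this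
    have h2 : (S.dG a b : ℝ) ≤ S.dG a c + S.dG b c := mod_cast this
    have h3 : (S.dG a b : ℝ) ≤ L := by linarith
    exact_mod_cast h3
  have hLℓ : (L : ℝ) ≤ ℓ * L := le_mul_of_one_le_left (by linarith) hℓ'
  have hsub : N.biUnion Bl ⊆ (S.ballG_fin y (3 * (ℓ * L))).toFinset := by
    intro c hc
    obtain ⟨a, ha, hca⟩ := Finset.mem_biUnion.1 hc
    simp only [Bl, Set.Finite.mem_toFinset, mem_ofPred_eq] at hca ⊢
    have h2 : (S.dG y c : ℝ) ≤ S.dG y a + S.dG a c := mod_cast S.dG_triangle y a c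
    linarith [hN a ha]
  have hmain : (N.card : ℝ) * (S.cA * ((L : ℝ) / 2) ^ S.α) ≤
      S.cA' * (3 * ((ℓ : ℝ) * L)) ^ S.α :=
    calc (N.card : ℝ) * (S.cA * ((L : ℝ) / 2) ^ S.α)
        = ∑ a ∈ N, S.cA * ((L : ℝ) / 2) ^ S.α := by simp
      _ ≤ ∑ a ∈ N, ∑ b ∈ Bl a, w b :=
          Finset.sum_le_sum fun a _ => S.ahlfors_lb a _ (by linarith)
      _ = ∑ b ∈ N.biUnion Bl, w b := (Finset.sum_biUnion hdisj).symm
      _ ≤ ∑ b ∈ (S.ballG_fin y (3 * (ℓ * L))).toFinset, w b :=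
          Finset.sum_le_sum_of_subset_of_nonneg hsub fun b _ _ => hw b
      _ ≤ _ := S.ahlfors_ub y _ (by linarith)
  have hsplit : (3 * ((ℓ : ℝ) * L)) ^ S.α = 6 ^ S.α * (ℓ : ℝ) ^ S.α * ((L : ℝ) / 2) ^ S.α := by
    rw [← Real.mul_rpow (by norm_num) (by linarith), ← Real.mul_rpow (by positivity) (by linarith)]
    ring_nf
  have hLα : 0 < ((L : ℝ) / 2) ^ S.α := Real.rpow_pos_of_pos (by linarith) _
  have hcA := S.cA_pos
  rw [hsplit] at hmain
  have : (N.card : ℝ) * S.cA ≤ S.cA' * (6 ^ S.α * (ℓ : ℝ) ^ S.α) := by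
    refine le_of_mul_le_mul_right ?_ hLα
    linarith
  rw [div_mul_eq_mul_div, div_mul_eq_mul_div, le_div_iff₀ hcA]
  linarith

theorem cA'_pos : 0 < S.cA' := by
  obtain ⟨y⟩ := S.infV.nonempty
  have h := (S.ahlfors_lb y 1 (by norm_num)).trans (S.ahlfors_ub y 1 (by norm_num))
  simp only [Real.one_rpow, mul_one] at h
  exact S.cA_pos.trans_le h

/-- Covering of a ball of radius `2ℓL` in `E` by at most `c ℓ ^ (α + β / 2)` balls of
radius `L`. -/
theorem exists_net {ℓ L : ℕ} (hℓ : 1 ≤ ℓ) (hL : 1 ≤ L) (x : S.E) :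
    ∃ Λ : Finset S.E, (Λ : Set S.E) ⊆ S.ball x (9 * ℓ * L) ∧
      (Λ.card : ℝ) ≤ S.cA' / S.cA * 6 ^ S.α * (4 * 2 ^ (S.β / 2) + 3) *
        (ℓ : ℝ) ^ (S.α + S.β / 2) ∧
      ∀ p ∈ S.ball x (2 * (ℓ * L)), ∃ x' ∈ Λ, S.dE x' p ≤ L := by
  have hβ := S.β_pos
  have hℓ' : (1 : ℝ) ≤ ℓ := mod_cast hℓ
  have hL' : (1 : ℝ) ≤ L := mod_cast hL
  obtain ⟨N, hNF, hsep, hcov⟩ := Finset.exists_separated_net (fun a b => S.dG a b ≤ L)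
    (fun a => by simp [S.dG_self]) (fun a b => by simp [S.dG_comm a b])
    (S.ballG_fin x.1 (2 * ℓ * L)).toFinset
  obtain ⟨M, hMcard, hMcov⟩ := Int.exists_net (b := S.β / 2) (by positivity) hℓ hL x.2
  have hNcard := S.card_le_of_separated hℓ hL x.1 N
    (fun a ha => by simpa using hNF ha) hsep
  refine ⟨(N ×ˢ M).filter (· ∈ S.ball x (9 * ℓ * L)), fun p hp => by simp at hp; exact hp.2,
    ?_, fun p hp => ?_⟩
  · calc _ ≤ ((N ×ˢ M).card : ℝ) := mod_cast Finset.card_filter_le _ _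
      _ = (N.card : ℝ) * M.card := by simp
      _ ≤ (S.cA' / S.cA * 6 ^ S.α * (ℓ : ℝ) ^ S.α) *
          ((4 * 2 ^ (S.β / 2) + 3) * (ℓ : ℝ) ^ (S.β / 2)) :=
          mul_le_mul hNcard hMcard (by positivity) (le_trans (by positivity) hNcard)
      _ = _ := by rw [Real.rpow_add (by linarith)]; ring
  · have hp' := (S.dE_le_iff x p (by positivity)).1 hp
    rw [← mul_assoc] at hp'
    obtain ⟨v, hv, hpv⟩ := hcov p.1 (by simpa using hp'.1)
    obtain ⟨t, ht, hpt⟩ := hMcov p.2 hp'.2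
    have hd : S.dE p (v, t) ≤ L :=
      (S.dE_le_iff _ _ (by positivity)).2 ⟨mod_cast hpv, hpt⟩
    refine ⟨(v, t), ?_, S.dE_comm p _ ▸ hd⟩
    simp only [Finset.mem_filter, Finset.mem_product, hv, ht, true_and]
    have h1 := S.dE_triangle x p (v, t)
    have h2 : S.dE x p ≤ 2 * (ℓ * L) := hp
    change S.dE x (v, t) ≤ _
    nlinarith

end GraphSetup

/-- Proposition 3.2 (3.11): the family `𝒜 = (A_{x,L})`, where `A_{x,L}` is the event that
`B(x,L)` is connected to `∂_int B(x,2L)` by a nearest-neighbour path on which the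
configuration vanishes, is a family of decreasing events on `{0,1}^E` that cascades with
complexity at most `α + β/2`. -/
theorem stmt10 (S : GraphSetup) (W : WalkLaw S) (cg cg' : ℝ) (hG : W.GreenBounds cg cg') :
    (∀ (x : S.E) (L : ℕ), S.DecreasingEvent
        {C : Set S.E | S.ConnectsIn Cᶜ (S.ball x L) (S.intBoundary (S.ball x (2 * L)))}) ∧
    ∃ c : ℝ, 0 < c ∧
      S.CascadesLe
        (fun x L =>
          {C : Set S.E | S.ConnectsIn Cᶜ (S.ball x L) (S.intBoundary (S.ball x (2 * L)))})
        (S.α + S.β / 2) c := by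
  have decr : ∀ (A B : Set S.E), S.DecreasingEvent {C : Set S.E | S.ConnectsIn Cᶜ A B} :=
    fun A B C C' hC h => ConnectsIn.mono (compl_subset_compl.2 hC) h
  refine ⟨fun x L => decr _ _,
    S.cA' / S.cA * 6 ^ S.α * (4 * 2 ^ (S.β / 2) + 3), ?_, ?_, ?_⟩
  · have := S.cA_pos
    have := S.cA'_pos
    positivity
  · intro x L hL C C' hCC'
    have key : ∀ C C' : Set S.E, C ∩ S.ball x (10 * L) = C' ∩ S.ball x (10 * L) →
        S.ConnectsIn Cᶜ (S.ball x L) (S.intBoundary (S.ball x (2 * L))) →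
        S.ConnectsIn C'ᶜ (S.ball x L) (S.intBoundary (S.ball x (2 * L))) := by
      intro C C' hCC' h
      have hL0 : (0 : ℝ) ≤ L := Nat.cast_nonneg _
      refine (h.inter_of_subset (ball_mono x (by linarith))).mono fun q hq hqC' => hq.1 ?_
      have hq10 : q ∈ S.ball x (10 * L) := ball_mono x (by linarith) hq.2
      exact (hCC'.ge ⟨hqC', hq10⟩).1
    exact ⟨key C C' hCC', key C' C hCC'.symm⟩
  · intro ℓ x L hL hℓ hdvd
    have hℓ100 : (100 : ℝ) ≤ ℓ := mod_cast Nat.le_of_dvd hℓ hdvd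
    have hL' : (1 : ℝ) ≤ L := mod_cast hL
    obtain ⟨Λ, hΛ, hcard, hcov⟩ := S.exists_net hℓ hL x
    refine ⟨Λ, hΛ, hcard, ?_⟩
    rintro C ⟨n, p, hp, h0, hn⟩
    push_cast at h0 hn
    have hprod : (100 : ℝ) * L ≤ ℓ * L := by gcongr
    obtain ⟨x', hx', hd'⟩ := hcov (p 0) (ball_mono x (by linarith) h0)
    obtain ⟨x'', hx'', hd''⟩ := hcov (p n) hn.1
    have h0' : S.dE x (p 0) ≤ ℓ * L := h0
    have hfar := lt_dE_of_mem_intBoundary hn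
    have hpn := S.dE_triangle x (p 0) (p n)
    have h1 := S.dE_triangle (p 0) x' (p n)
    have h2 := S.dE_triangle x' x'' (p n)
    have h3 := S.dE_triangle (p 0) x'' (p n)
    rw [S.dE_comm (p 0) x'] at h1
    rw [S.dE_comm (p 0) x''] at h3
    simp only [mem_iUnion]
    refine ⟨x', hx', x'', hx'', by push_cast; linarith, ?_, ?_⟩
    · exact hp.connectsIn_ball (by linarith) hd' (by linarith)
    · exact hp.reverse.connectsIn_ball (by linarith) (by simpa using hd'')
        (by simp only [Nat.sub_self]; linarith)
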